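/- arXiv:2407.12444 — 2 statements merged into one kernel-verified Lean document; each statement's English description precedes it below -/
import Mathlib

section
/- For every (y₁, y₂) ∈ ℝ² with 0 < y₁ < 1 and 0 < y₂ < y₁²/2, the system of equations s₀^{−4α} = y₁ and α s₀^{−4α−2} = y₂ has exactly one solution (s₀, α) with s₀ ∈ (1, +∞) and α ∈ (0, 1/2). -/
/-- For `L < 0`, the map `a ↦ a * exp (L / (2 * a))` is strictly increasing on `(0, ∞)`. -/
theorem strictMonoOn_mul_exp_div {L : ℝ} (hL : L < 0) :
    StrictMonoOn (fun a : ℝ => a * Real.exp (L / (2 * a))) (Set.Ioi 0) := by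
  intro a (ha : 0 < a) b _ hab
  have hb : 0 < b := ha.trans hab
  have h : L / (2 * a) < L / (2 * b) := by
    rw [div_lt_div_iff₀ (by positivity) (by positivity)]
    nlinarith
  exact mul_lt_mul hab (Real.exp_le_exp.2 h.le) (Real.exp_pos _) hb.le

/-- Eliminating `s` from the system `s ^ (-4 * a) = y₁`, `a * s ^ (-4 * a - 2) = y₂`. -/
theorem rpow_system_iff {y₁ y₂ s a : ℝ} (hy₁ : 0 < y₁) (hs : 0 < s) (ha : 0 < a) :
    (s ^ (-4 * a) = y₁ ∧ a * s ^ (-4 * a - 2) = y₂) ↔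
      s = Real.exp (-Real.log y₁ / (4 * a)) ∧
        a * Real.exp (Real.log y₁ / (2 * a)) = y₂ / y₁ := by
  have h₁ : s ^ (-4 * a) = y₁ ↔ s = Real.exp (-Real.log y₁ / (4 * a)) := by
    rw [Real.rpow_def_of_pos hs, ← Real.exp_log hy₁, Real.exp_eq_exp, Real.exp_log hy₁]
    nth_rewrite 2 [← Real.exp_log hs]
    rw [Real.exp_eq_exp, eq_div_iff (by positivity)]
    constructor <;> intro h <;> linarith
  rw [h₁]
  refine and_congr_right fun h => ?_
  have h₂ : s ^ (-2 : ℝ) = Real.exp (Real.log y₁ / (2 * a)) := by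
    rw [h, ← Real.exp_mul]
    congr 1
    field_simp
    norm_num
  rw [sub_eq_add_neg, Real.rpow_add hs, h₁.2 h, h₂, eq_div_iff hy₁.ne']
  ring_nf

/-- For every `(y₁, y₂)` with `0 < y₁ < 1` and `0 < y₂ < y₁²/2`, the system
`s₀^(-4α) = y₁`, `α * s₀^(-4α-2) = y₂` has exactly one solution `(s₀, α)` with
`s₀ ∈ (1, ∞)` and `α ∈ (0, 1/2)` (real powers). -/
theorem stmt_12
    (y₁ y₂ : ℝ) (hy₁ : 0 < y₁ ∧ y₁ < 1) (hy₂ : 0 < y₂ ∧ y₂ < y₁ ^ 2 / 2) :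
    ∃! p : ℝ × ℝ,
      (1 < p.1 ∧ 0 < p.2 ∧ p.2 < 1 / 2)
        ∧ p.1 ^ (-4 * p.2) = y₁
        ∧ p.2 * p.1 ^ (-4 * p.2 - 2) = y₂ := by
  obtain ⟨hy, hy'⟩ := hy₁
  have hL : Real.log y₁ < 0 := Real.log_neg hy hy'
  have hmono := strictMonoOn_mul_exp_div hL
  have hc : 0 < y₂ / y₁ := div_pos hy₂.1 hy
  have hc' : y₂ / y₁ < y₁ / 2 := by
    rw [div_lt_iff₀ hy]
    linarith [hy₂.2, sq y₁]
  have hcont : ContinuousOn (fun a : ℝ => a * Real.exp (Real.log y₁ / (2 * a)))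
      (Set.Icc (y₂ / y₁) (1 / 2)) := by
    refine continuousOn_id.mul (Real.continuous_exp.comp_continuousOn
      (continuousOn_const.div (by fun_prop) fun a ha => ?_))
    have : 0 < a := hc.trans_le ha.1
    positivity
  obtain ⟨a, ⟨hca, ha⟩, hga⟩ := intermediate_value_Ioo (by linarith) hcont
    (show y₂ / y₁ ∈ Set.Ioo _ _ from by
      constructor
      · exact mul_lt_of_lt_one_right hc
          (Real.exp_lt_one_iff.2 (div_neg_of_neg_of_pos hL (by positivity)))
      · norm_num [Real.exp_log hy]
        linarith)
  have ha0 : 0 < a := hc.trans hca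
  refine ⟨(Real.exp (-Real.log y₁ / (4 * a)), a), ⟨⟨?_, ha0, ha⟩, ?_⟩, ?_⟩
  · exact Real.one_lt_exp_iff.2 (div_pos (neg_pos.2 hL) (by positivity))
  · exact (rpow_system_iff hy (Real.exp_pos _) ha0).2 ⟨rfl, hga⟩
  · rintro ⟨s, b⟩ ⟨⟨hs, hb, -⟩, h⟩
    obtain ⟨hs', hgb⟩ := (rpow_system_iff hy (one_pos.trans hs) hb).1 h
    obtain rfl : b = a := hmono.injOn hb ha0 (hgb.trans hga.symm)
    exact Prod.ext hs' rfl
end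

section
/- Let (y₁, y₂) ∈ ℝ² with 0 < y₁ < 1 and 0 < y₂ < y₁²/2, and let (s₀, α) ∈ (1, +∞) × (0, 1/2) be the unique solution of the system s₀^{−4α} = y₁ and α s₀^{−4α−2} = y₂. Then, setting G = 2 ln s₀, one has G > 0, G e^G = −y₁ ln(y₁)/(2 y₂), and α = (y₂ / y₁) e^G; equivalently, s₀ = exp(G/2) where G is the unique positive real number satisfying G e^G = −y₁ ln(y₁)/(2 y₂). -/
/-- If `(s₀, α) ∈ (1, ∞) × (0, 1/2)` solves `s₀^(-4α) = y₁`,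
`α s₀^(-4α-2) = y₂` for `(y₁, y₂)` in the feasible region, then `G := 2 ln s₀` satisfies
`G > 0`, `G e^G = -y₁ ln y₁ / (2 y₂)` and `α = (y₂/y₁) e^G`; moreover `s₀ = exp (G/2)` where
`G` is the unique positive real with `G e^G = -y₁ ln y₁ / (2 y₂)` (the Lambert W value). -/
theorem stmt_13
    (y₁ y₂ : ℝ) (hy₁ : 0 < y₁ ∧ y₁ < 1) (hy₂ : 0 < y₂ ∧ y₂ < y₁ ^ 2 / 2)
    (s₀ α : ℝ) (hs₀ : 1 < s₀) (hα : 0 < α ∧ α < 1 / 2)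
    (heq1 : s₀ ^ (-4 * α) = y₁) (heq2 : α * s₀ ^ (-4 * α - 2) = y₂) :
    0 < 2 * Real.log s₀
      ∧ (2 * Real.log s₀) * Real.exp (2 * Real.log s₀) = -(y₁ * Real.log y₁) / (2 * y₂)
      ∧ α = (y₂ / y₁) * Real.exp (2 * Real.log s₀)
      ∧ s₀ = Real.exp ((2 * Real.log s₀) / 2)
      ∧ (∀ G' : ℝ, 0 < G' → G' * Real.exp G' = -(y₁ * Real.log y₁) / (2 * y₂) →
          G' = 2 * Real.log s₀) := by
  have hs : 0 < s₀ := by linarith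
  have hL : 0 < Real.log s₀ := Real.log_pos hs₀
  have hexp : Real.exp (2 * Real.log s₀) = s₀ ^ 2 := by
    rw [two_mul, Real.exp_add, Real.exp_log hs, sq]
  have hlog : Real.log y₁ = -4 * α * Real.log s₀ := by
    rw [← heq1, Real.log_rpow hs]
  have hy : y₂ = α * (y₁ / s₀ ^ 2) := by
    rw [← heq2, Real.rpow_sub hs, heq1, Real.rpow_two]
  have hy₁_ne : y₁ ≠ 0 := hy₁.1.ne'
  have hα_ne : α ≠ 0 := hα.1.ne'
  have hG : 2 * Real.log s₀ * Real.exp (2 * Real.log s₀)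
      = -(y₁ * Real.log y₁) / (2 * y₂) := by
    rw [hexp, hlog, hy]
    field_simp
    ring
  refine ⟨by positivity, hG, ?_, ?_, fun G' hG' h => ?_⟩
  · rw [hexp, hy]
    field_simp
  · rw [mul_div_cancel_left₀ _ two_ne_zero, Real.exp_log hs]
  · have h_eq := h.trans hG.symm
    rcases lt_trichotomy G' (2 * Real.log s₀) with hlt | heq | hgt
    · exact absurd h_eq
        (mul_lt_mul'' hlt (Real.exp_lt_exp.2 hlt) hG'.le (Real.exp_pos _).le).ne
    · exact heq
    · exact absurd h_eq
        (mul_lt_mul'' hgt (Real.exp_lt_exp.2 hgt) (by positivity) (Real.exp_pos _).le).ne'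
end
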